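/- arXiv:2601.16039 — 6 statements merged into one kernel-verified Lean document; each statement's English description precedes it below -/
import Mathlib

section
/- Let (M, E, ≺) be a tree-ordered graph, let t be a positive integer such that E does not contain K_{t,t} as a subgraph, and let I, J be finite linear orders with min(|I|,|J|) ≥ 2t. Let (μ,μ') be a regular pair of (I,J)-meshes in M. Then ¬E(μ(i,j), μ'(i',j')) for all pairs of indices (i,j) ≠ (i',j') in I×J. Hence, if additionally both meshes μ and μ' are regular, then either E(x,y) fails for all x, y ∈ V(μ) ∪ V(μ') (this set is E-independent), or E(μ(i,j), μ'(i,j)) holds for every (i,j) ∈ I×J and these pairs are the only E-edges between elements of V(μ) ∪ V(μ') (the set induces a perfect matching). -/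
/-- A tree-order on `M` is a strict partial order `prec` with a least element (the root)
such that the set of `prec`-predecessors of any element is linearly ordered by `prec`. -/
def IsTreeOrder {M : Type*} (prec : M → M → Prop) : Prop :=
  (∀ x, ¬ prec x x) ∧
  (∀ x y z, prec x y → prec y z → prec x z) ∧
  (∃ r : M, ∀ x, x ≠ r → prec r x) ∧
  (∀ x y z, prec y x → prec z x → prec y z ∨ y = z ∨ prec z y)

/-- Pairs `(u,v)` and `(u',v')` of elements of a tree-ordered graph `(M, E, prec)` have the
same atomic type. -/
def AtpEq {M : Type*} (E prec : M → M → Prop) (u v u' v' : M) : Prop :=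
  ((u = v) ↔ (u' = v')) ∧ (E u v ↔ E u' v') ∧
  (prec u v ↔ prec u' v') ∧ (prec v u ↔ prec v' u')

/-- A pair `(μ, μ')` of `(I,J)`-meshes is regular if the atomic type of
`(μ(i,j), μ'(i',j'))` depends only on the order types of `(i,i')` and `(j,j')`. -/
def IsRegularPair {M I J : Type*} [LinearOrder I] [LinearOrder J]
    (E prec : M → M → Prop) (μ μ' : I × J → M) : Prop :=
  ∀ (i₁ i₁' i₂ i₂' : I) (j₁ j₁' j₂ j₂' : J),
    cmp i₁ i₁' = cmp i₂ i₂' → cmp j₁ j₁' = cmp j₂ j₂' →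
    AtpEq E prec (μ (i₁, j₁)) (μ' (i₁', j₁')) (μ (i₂, j₂)) (μ' (i₂', j₂'))

/-- A pair `(μ, μ')` of `(I,J)`-meshes is homogeneous if the atomic type of
`(μ(i,j), μ'(i',j'))` is the same for all `i, i', j, j'`. -/
def IsHomogeneousPair {M I J : Type*} [LinearOrder I] [LinearOrder J]
    (E prec : M → M → Prop) (μ μ' : I × J → M) : Prop :=
  ∀ (i₁ i₁' i₂ i₂' : I) (j₁ j₁' j₂ j₂' : J),
    AtpEq E prec (μ (i₁, j₁)) (μ' (i₁', j₁')) (μ (i₂, j₂)) (μ' (i₂', j₂'))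

/-- A pair `(μ, μ')` of `(I,J)`-meshes is quasi-homogeneous if it is regular and the atomic
type of `(μ(i,j), μ'(i',j'))` is the same for all `(i,j) ≠ (i',j')`. -/
def IsQuasiHomogeneousPair {M I J : Type*} [LinearOrder I] [LinearOrder J]
    (E prec : M → M → Prop) (μ μ' : I × J → M) : Prop :=
  IsRegularPair E prec μ μ' ∧
  ∀ (i₁ i₁' i₂ i₂' : I) (j₁ j₁' j₂ j₂' : J),
    (i₁, j₁) ≠ (i₁', j₁') → (i₂, j₂) ≠ (i₂', j₂') →
    AtpEq E prec (μ (i₁, j₁)) (μ' (i₁', j₁')) (μ (i₂, j₂)) (μ' (i₂', j₂'))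

/-- A pair of meshes is matching if it is quasi-homogeneous but not homogeneous. -/
def IsMatchingPair {M I J : Type*} [LinearOrder I] [LinearOrder J]
    (E prec : M → M → Prop) (μ μ' : I × J → M) : Prop :=
  IsQuasiHomogeneousPair E prec μ μ' ∧ ¬ IsHomogeneousPair E prec μ μ'

/-- The relation `E` contains `K_{s,t}` as a subgraph if there are disjoint subsets
`A`, `B` of `M` with `|A| = s`, `|B| = t` and `E a b` for all `a ∈ A`, `b ∈ B`. -/
def ContainsBiclique {M : Type*} (E : M → M → Prop) (s t : ℕ) : Prop :=
  ∃ A B : Finset M, Disjoint A B ∧ A.card = s ∧ B.card = t ∧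
    ∀ a ∈ A, ∀ b ∈ B, E a b

/-- A subset of `M` is an antichain for `prec` if no two distinct elements of it are
comparable. -/
def IsPrecAntichain {M : Type*} (prec : M → M → Prop) (S : Set M) : Prop :=
  ∀ x ∈ S, ∀ y ∈ S, x ≠ y → ¬ prec x y ∧ ¬ prec y x

/-- Two injective sequences over a linear order with at least `2 * t` elements span a biclique if
adjacency of `f a` and `g b` depends only on how `a` and `b` compare and holds for some
`a ≠ b`. -/
theorem containsBiclique_of_cmp {M I : Type*} [LinearOrder I] [Fintype I] {E : M → M → Prop}
    (hE_irr : ∀ x, ¬ E x x) {t : ℕ} (hcard : 2 * t ≤ Fintype.card I) {f g : I → M}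
    (hf : Function.Injective f) (hg : Function.Injective g)
    (hreg : ∀ a b c d : I, cmp a b = cmp c d → (E (f a) (g b) ↔ E (f c) (g d)))
    {a b : I} (hne : a ≠ b) (hab : E (f a) (g b)) : ContainsBiclique E t t := by
  let e : Fin (2 * t) ↪o I := Finset.orderEmbOfCardLe Finset.univ hcard
  let lo : Fin t ↪ I := ⟨fun k => e ⟨k, by omega⟩, fun k l h => by
    have := congrArg Fin.val (e.injective h)
    exact Fin.ext this⟩
  let hi : Fin t ↪ I := ⟨fun k => e ⟨t + k, by omega⟩, fun k l h => by
    have := congrArg Fin.val (e.injective h)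
    exact Fin.ext (Nat.add_left_cancel this)⟩
  have hlt : ∀ k l, lo k < hi l := fun k l => e.lt_iff_lt.2 (Fin.mk_lt_mk.2 (by omega))
  obtain ⟨p, q, hpq⟩ : ∃ p q : Fin t ↪ I, ∀ k l, E (f (p k)) (g (q l)) := by
    rcases hne.lt_or_gt with h | h
    · exact ⟨lo, hi, fun k l => (hreg _ _ _ _
        (((cmp_eq_lt_iff _ _).2 h).trans ((cmp_eq_lt_iff _ _).2 (hlt k l)).symm)).1 hab⟩
    · exact ⟨hi, lo, fun k l => (hreg _ _ _ _
        (((cmp_eq_gt_iff _ _).2 h).trans ((cmp_eq_gt_iff _ _).2 (hlt l k)).symm)).1 hab⟩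
  refine ⟨Finset.univ.map (p.trans ⟨f, hf⟩), Finset.univ.map (q.trans ⟨g, hg⟩),
    ?_, by simp, by simp, ?_⟩
  · rw [Finset.disjoint_left]
    intro x hx hx'
    obtain ⟨k, -, rfl⟩ := Finset.mem_map.1 hx
    obtain ⟨l, -, hl⟩ := Finset.mem_map.1 hx'
    have h := hpq k l
    change g (q l) = f (p k) at hl
    rw [hl] at h
    exact hE_irr _ h
  · simpa using hpq

/-- In a regular pair of sufficiently large meshes over a graph without `K_{t,t}`, no two
elements at distinct indices are adjacent. -/
theorem IsRegularPair.not_adj_of_ne {M I J : Type*} {E prec : M → M → Prop}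
    (hE_irr : ∀ x, ¬ E x x) {t : ℕ} (hbic : ¬ ContainsBiclique E t t)
    [LinearOrder I] [LinearOrder J] [Fintype I] [Fintype J]
    (hcard : 2 * t ≤ min (Fintype.card I) (Fintype.card J))
    {μ μ' : I × J → M} (hμ : Function.Injective μ) (hμ' : Function.Injective μ')
    (hpair : IsRegularPair E prec μ μ') {p q : I × J} (hne : p ≠ q) : ¬ E (μ p) (μ' q) := by
  obtain ⟨i, j⟩ := p
  obtain ⟨i', j'⟩ := q
  intro hE
  by_cases hi : i = i'
  · have hj : j ≠ j' := fun hj => hne (by rw [hi, hj])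
    exact hbic (containsBiclique_of_cmp hE_irr (hcard.trans (min_le_right _ _))
      (f := fun b => μ (i, b)) (g := fun b => μ' (i', b))
      (hμ.comp (Prod.mk_right_injective i)) (hμ'.comp (Prod.mk_right_injective i'))
      (fun a b c d h => (hpair i i' i i' a b c d rfl h).2.1) hj hE)
  · exact hbic (containsBiclique_of_cmp hE_irr (hcard.trans (min_le_left _ _))
      (f := fun a => μ (a, j)) (g := fun a => μ' (a, j'))
      (hμ.comp (Prod.mk_left_injective j)) (hμ'.comp (Prod.mk_left_injective j'))
      (fun a b c d h => (hpair a b c d j j' j j' h rfl).2.1) hi hE)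

theorem stmt7 {M I J : Type*} (E prec : M → M → Prop)
    (hE_symm : ∀ x y, E x y → E y x) (hE_irr : ∀ x, ¬ E x x)
    (htree : IsTreeOrder prec)
    (t : ℕ) (ht : 0 < t) (hbic : ¬ ContainsBiclique E t t)
    [LinearOrder I] [LinearOrder J] [Fintype I] [Fintype J]
    (hcard : 2 * t ≤ min (Fintype.card I) (Fintype.card J))
    (μ μ' : I × J → M) (hμ : Function.Injective μ) (hμ' : Function.Injective μ')
    (hpair : IsRegularPair E prec μ μ') :
    (∀ (i i' : I) (j j' : J), (i, j) ≠ (i', j') → ¬ E (μ (i, j)) (μ' (i', j'))) ∧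
    (IsRegularPair E prec μ μ → IsRegularPair E prec μ' μ' →
      ((∀ x ∈ Set.range μ ∪ Set.range μ', ∀ y ∈ Set.range μ ∪ Set.range μ', ¬ E x y) ∨
       ((∀ (i : I) (j : J), E (μ (i, j)) (μ' (i, j))) ∧
        ∀ x y : M, x ∈ Set.range μ ∪ Set.range μ' → y ∈ Set.range μ ∪ Set.range μ' →
          E x y → ∃ (i : I) (j : J),
            (x = μ (i, j) ∧ y = μ' (i, j)) ∨ (x = μ' (i, j) ∧ y = μ (i, j))))) := by
  have hcross : ∀ p q, E (μ p) (μ' q) → p = q := fun p q h =>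
    of_not_not fun hne => hpair.not_adj_of_ne hE_irr hbic hcard hμ hμ' hne h
  refine ⟨fun i i' j j' hne h => hne (hcross _ _ h), fun hreg hreg' => ?_⟩
  have hindep : ∀ ν : I × J → M, Function.Injective ν → IsRegularPair E prec ν ν →
      ∀ p q, ¬ E (ν p) (ν q) := by
    intro ν hν hr p q h
    by_cases hne : p = q
    · exact hE_irr _ (hne ▸ h)
    · exact hr.not_adj_of_ne hE_irr hbic hcard hν hν hne h
  have hedge : ∀ x y : M, x ∈ Set.range μ ∪ Set.range μ' → y ∈ Set.range μ ∪ Set.range μ' →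
      E x y → ∃ (i : I) (j : J),
        (x = μ (i, j) ∧ y = μ' (i, j)) ∨ (x = μ' (i, j) ∧ y = μ (i, j)) := by
    rintro _ _ (⟨p, rfl⟩ | ⟨p, rfl⟩) (⟨q, rfl⟩ | ⟨q, rfl⟩) h
    · exact (hindep μ hμ hreg p q h).elim
    · obtain rfl := hcross p q h
      exact ⟨p.1, p.2, Or.inl ⟨rfl, rfl⟩⟩
    · obtain rfl := hcross q p (hE_symm _ _ h)
      exact ⟨q.1, q.2, Or.inr ⟨rfl, rfl⟩⟩
    · exact (hindep μ' hμ' hreg' p q h).elim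
  by_cases hdiag : ∃ i j, E (μ (i, j)) (μ' (i, j))
  · obtain ⟨i, j, h⟩ := hdiag
    refine Or.inr ⟨fun a b => ?_, hedge⟩
    exact (hpair i i a a j j b b (by simp) (by simp)).2.1.1 h
  · refine Or.inl fun x hx y hy h => hdiag ?_
    obtain ⟨i, j, ⟨rfl, rfl⟩ | ⟨rfl, rfl⟩⟩ := hedge x y hx hy h
    · exact ⟨i, j, h⟩
    · exact ⟨i, j, hE_symm _ _ h⟩
end

section
/- Let (M, E, ≺) be a tree-ordered graph, let t be a positive integer such that E does not contain K_{t,t} as a subgraph, and let I, J be finite linear orders with |I|, |J| ≥ max(2t, 5). Let (μ,μ') be a regular pair of (I,J)-meshes in M such that both V(μ) and V(μ') are antichains for ≺. Then the pair (μ,μ') is quasi-homogeneous. -/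
/-- A finite linear order with at least `2 * n` elements has two `n`-element subsets, one
lying entirely below the other. -/
theorem exists_finset_card_forall_lt {I : Type*} [LinearOrder I] [Fintype I] {n : ℕ}
    (h : 2 * n ≤ Fintype.card I) :
    ∃ L U : Finset I, L.card = n ∧ U.card = n ∧ ∀ a ∈ L, ∀ b ∈ U, a < b := by
  let f : Fin (2 * n) ↪o I := Finset.univ.orderEmbOfCardLe h
  let l : Fin n ↪ I :=
    (⟨fun k => ⟨k, by omega⟩, fun a b hab => by simpa [Fin.ext_iff] using hab⟩ :
      Fin n ↪ Fin (2 * n)).trans f.toEmbedding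
  let u : Fin n ↪ I :=
    (⟨fun k => ⟨n + k, by omega⟩, fun a b hab => by simpa [Fin.ext_iff] using hab⟩ :
      Fin n ↪ Fin (2 * n)).trans f.toEmbedding
  refine ⟨Finset.univ.map l, Finset.univ.map u, by simp, by simp, ?_⟩
  simp only [Finset.mem_map, Finset.mem_univ, true_and]
  rintro _ ⟨a, rfl⟩ _ ⟨b, rfl⟩
  exact f.lt_iff_lt.mpr (Fin.mk_lt_mk.mpr (by omega))

/-- In a finite linear order with at least `2 * n` elements, the order type of any two distinct
elements is realised uniformly between two `n`-element subsets. -/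
theorem exists_finset_card_forall_cmp {I : Type*} [LinearOrder I] [Fintype I] {n : ℕ}
    (h : 2 * n ≤ Fintype.card I) {i i' : I} (hne : i ≠ i') :
    ∃ A B : Finset I, A.card = n ∧ B.card = n ∧ ∀ a ∈ A, ∀ b ∈ B, cmp a b = cmp i i' := by
  obtain ⟨L, U, hL, hU, hLU⟩ := exists_finset_card_forall_lt h
  rcases hne.lt_or_gt with hi | hi
  · exact ⟨L, U, hL, hU, fun a ha b hb => by
      rw [hi.cmp_eq_lt, (hLU a ha b hb).cmp_eq_lt]⟩
  · exact ⟨U, L, hU, hL, fun a ha b hb => by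
      rw [hi.cmp_eq_gt, (hLU b hb a ha).cmp_eq_gt]⟩

/-- The order type of two distinct elements of a product of two large linear orders is realised
uniformly between two `n`-element subsets. -/
theorem exists_finset_prod_card_forall_cmp {I J : Type*} [LinearOrder I] [LinearOrder J]
    [Fintype I] [Fintype J] {n : ℕ} (hI : 2 * n ≤ Fintype.card I) (hJ : 2 * n ≤ Fintype.card J)
    {p q : I × J} (hne : p ≠ q) :
    ∃ A B : Finset (I × J), A.card = n ∧ B.card = n ∧
      ∀ a ∈ A, ∀ b ∈ B, cmp a.1 b.1 = cmp p.1 q.1 ∧ cmp a.2 b.2 = cmp p.2 q.2 := by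
  by_cases h : p.1 = q.1
  · obtain ⟨A, B, hA, hB, hAB⟩ :=
      exists_finset_card_forall_cmp hJ fun h' : p.2 = q.2 => hne (Prod.ext h h')
    refine ⟨{p.1} ×ˢ A, {q.1} ×ˢ B, by simpa, by simpa, fun a ha b hb => ?_⟩
    simp only [Finset.mem_product, Finset.mem_singleton] at ha hb
    exact ⟨by rw [ha.1, hb.1], hAB _ ha.2 _ hb.2⟩
  · obtain ⟨A, B, hA, hB, hAB⟩ := exists_finset_card_forall_cmp hI h
    refine ⟨A ×ˢ {p.2}, B ×ˢ {q.2}, by simpa, by simpa, fun a ha b hb => ?_⟩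
    simp only [Finset.mem_product, Finset.mem_singleton] at ha hb
    exact ⟨hAB _ ha.1 _ hb.1, by rw [ha.2, hb.2]⟩

/-- In a regular pair, the atomic type of two distinct positions is realised uniformly between
two `n`-element sets of positions. -/
theorem IsRegularPair.exists_finset_card_forall_atpEq {M I J : Type*} [LinearOrder I]
    [LinearOrder J] [Fintype I] [Fintype J] {E prec : M → M → Prop} {μ μ' : I × J → M}
    (hpair : IsRegularPair E prec μ μ') {n : ℕ}
    (hI : 2 * n ≤ Fintype.card I) (hJ : 2 * n ≤ Fintype.card J) {p q : I × J} (hne : p ≠ q) :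
    ∃ A B : Finset (I × J), A.card = n ∧ B.card = n ∧
      ∀ a ∈ A, ∀ b ∈ B, AtpEq E prec (μ p) (μ' q) (μ a) (μ' b) := by
  obtain ⟨A, B, hA, hB, hAB⟩ := exists_finset_prod_card_forall_cmp hI hJ hne
  exact ⟨A, B, hA, hB, fun a ha b hb =>
    hpair _ _ _ _ _ _ _ _ (hAB a ha b hb).1.symm (hAB a ha b hb).2.symm⟩

/-- In a tree-order, two distinct elements of an antichain have no common upper bound. -/
theorem IsPrecAntichain.not_prec_of_prec {M : Type*} {prec : M → M → Prop} {S : Set M}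
    (hS : IsPrecAntichain prec S) (htree : IsTreeOrder prec) {x y z : M} (hx : x ∈ S)
    (hy : y ∈ S) (hne : x ≠ y) (hxz : prec x z) : ¬ prec y z := fun hyz => by
  rcases htree.2.2.2 z x y hxz hyz with h | h | h
  · exact (hS x hx y hy hne).1 h
  · exact hne h
  · exact (hS x hx y hy hne).2 h

theorem stmt8 {M I J : Type*} (E prec : M → M → Prop)
    (hE_symm : ∀ x y, E x y → E y x) (hE_irr : ∀ x, ¬ E x x)
    (htree : IsTreeOrder prec)
    (t : ℕ) (ht : 0 < t) (hbic : ¬ ContainsBiclique E t t)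
    [LinearOrder I] [LinearOrder J] [Fintype I] [Fintype J]
    (hcardI : max (2 * t) 5 ≤ Fintype.card I) (hcardJ : max (2 * t) 5 ≤ Fintype.card J)
    (μ μ' : I × J → M) (hμ : Function.Injective μ) (hμ' : Function.Injective μ')
    (hpair : IsRegularPair E prec μ μ')
    (hanti : IsPrecAntichain prec (Set.range μ))
    (hanti' : IsPrecAntichain prec (Set.range μ')) :
    IsQuasiHomogeneousPair E prec μ μ' := by
  have hfalse : ∀ p q : I × J, p ≠ q →
      μ p ≠ μ' q ∧ ¬ E (μ p) (μ' q) ∧ ¬ prec (μ p) (μ' q) ∧ ¬ prec (μ' q) (μ p) := by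
    intro p q hne
    obtain ⟨A, B, hA, hB, hAB⟩ :=
      hpair.exists_finset_card_forall_atpEq (n := 2) (by omega) (by omega) hne
    obtain ⟨a, ha, a₂, ha₂, haa⟩ := Finset.one_lt_card.mp (hA ▸ one_lt_two)
    obtain ⟨b, hb, b₂, hb₂, hbb⟩ := Finset.one_lt_card.mp (hB ▸ one_lt_two)
    have hab := hAB a ha b hb
    have ha₂b := hAB a₂ ha₂ b hb
    have hab₂ := hAB a ha b₂ hb₂
    have hμne : μ p ≠ μ' q := fun h =>
      haa (hμ ((hab.1.mp h).trans (ha₂b.1.mp h).symm))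
    refine ⟨hμne, fun h => ?_, fun h => ?_, fun h => ?_⟩
    · obtain ⟨C, D, hC, hD, hCD⟩ :=
        hpair.exists_finset_card_forall_atpEq (n := t) (by omega) (by omega) hne
      refine hbic ⟨C.map ⟨μ, hμ⟩, D.map ⟨μ', hμ'⟩, ?_, by simpa, by simpa, ?_⟩
      · rw [Finset.disjoint_left]
        simp only [Finset.mem_map, Function.Embedding.coeFn_mk]
        rintro _ ⟨c, hc, rfl⟩ ⟨d, hd, hdc⟩
        exact hμne ((hCD c hc d hd).1.mpr hdc.symm)
      · simp only [Finset.mem_map, Function.Embedding.coeFn_mk]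
        rintro _ ⟨c, hc, rfl⟩ _ ⟨d, hd, rfl⟩
        exact (hCD c hc d hd).2.1.mp h
    · exact hanti.not_prec_of_prec htree ⟨a, rfl⟩ ⟨a₂, rfl⟩ (hμ.ne haa)
        (hab.2.2.1.mp h) (ha₂b.2.2.1.mp h)
    · exact hanti'.not_prec_of_prec htree ⟨b, rfl⟩ ⟨b₂, rfl⟩ (hμ'.ne hbb)
        (hab.2.2.2.mp h) (hab₂.2.2.2.mp h)
  refine ⟨hpair, fun i₁ i₁' i₂ i₂' j₁ j₁' j₂ j₂' h₁ h₂ => ?_⟩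
  obtain ⟨e₁, E₁, l₁, g₁⟩ := hfalse _ _ h₁
  obtain ⟨e₂, E₂, l₂, g₂⟩ := hfalse _ _ h₂
  exact ⟨iff_of_false e₁ e₂, iff_of_false E₁ E₂, iff_of_false l₁ l₂, iff_of_false g₁ g₂⟩
end

section
/- Let (M, E, ≺) be a tree-ordered graph, let t be a positive integer such that E does not contain K_{t,t} as a subgraph, and let I, J be finite linear orders with min(|I|,|J|) ≥ max(2t, 4). Let (μ,μ') be a conducting pair of (I,J)-meshes in M such that μ is inner-vertical and μ' is inner-horizontal. Then the pair (μ,μ') is matching; moreover it is homogeneous with respect to ≺, i.e., whether μ(i,j) ≺ μ'(i',j') holds does not depend on i, j, i', j', and likewise whether μ'(i',j') ≺ μ(i,j) holds does not depend on i, j, i', j'. -/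
/-- The set of elements of a finite nonempty linear order distinct from the minimum
and the maximum. -/
def innerSet (J : Type*) [LinearOrder J] [Fintype J] [Nonempty J] : Set J :=
  {j | j ≠ Finset.univ.min' Finset.univ_nonempty ∧
       j ≠ Finset.univ.max' Finset.univ_nonempty}

/-- The minimum of a finite nonempty linear order. -/
def minOf (J : Type*) [LinearOrder J] [Fintype J] [Nonempty J] : J :=
  Finset.univ.min' Finset.univ_nonempty

/-- The maximum of a finite nonempty linear order. -/
def maxOf (J : Type*) [LinearOrder J] [Fintype J] [Nonempty J] : J :=
  Finset.univ.max' Finset.univ_nonempty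

/-- `a : I → M` is a vertical guard of the mesh `μ`: the atomic type of
`(μ(i,j), a(i'))` depends only on `otp(i,i')`, and it is not the same for all indices. -/
def IsVerticalGuard {M I J : Type*} [LinearOrder I] [LinearOrder J]
    (E prec : M → M → Prop) (μ : I × J → M) (a : I → M) : Prop :=
  (∀ (i i' i₂ i₂' : I) (j j₂ : J), cmp i i' = cmp i₂ i₂' →
    AtpEq E prec (μ (i, j)) (a i') (μ (i₂, j₂)) (a i₂')) ∧
  ¬ ∀ (i i' i₂ i₂' : I) (j j₂ : J),
    AtpEq E prec (μ (i, j)) (a i') (μ (i₂, j₂)) (a i₂')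

/-- `b : J → M` is a horizontal guard of the mesh `μ`: the atomic type of
`(μ(i,j), b(j'))` depends only on `otp(j,j')`, and it is not the same for all indices. -/
def IsHorizontalGuard {M I J : Type*} [LinearOrder I] [LinearOrder J]
    (E prec : M → M → Prop) (μ : I × J → M) (b : J → M) : Prop :=
  (∀ (j j' j₂ j₂' : J) (i i₂ : I), cmp j j' = cmp j₂ j₂' →
    AtpEq E prec (μ (i, j)) (b j') (μ (i₂, j₂)) (b j₂')) ∧
  ¬ ∀ (j j' j₂ j₂' : J) (i i₂ : I),
    AtpEq E prec (μ (i, j)) (b j') (μ (i₂, j₂)) (b j₂')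

/-- A mesh is inner-vertical if it is regular (hence pseudo-vertical) and the restriction
of `μ` to `I × (J \ {min J, max J})` has the vertical guard `a(i) = μ(i, min J)` or
`a(i) = μ(i, max J)`. -/
def IsInnerVertical {M I J : Type*} [LinearOrder I] [LinearOrder J]
    [Fintype J] [Nonempty J] (E prec : M → M → Prop) (μ : I × J → M) : Prop :=
  IsRegularPair E prec μ μ ∧
  (IsVerticalGuard E prec (fun p : I × ↥(innerSet J) => μ (p.1, ↑p.2))
      (fun i => μ (i, minOf J)) ∨
   IsVerticalGuard E prec (fun p : I × ↥(innerSet J) => μ (p.1, ↑p.2))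
      (fun i => μ (i, maxOf J)))

/-- A mesh is inner-horizontal if it is regular (hence pseudo-horizontal) and the
restriction of `μ` to `(I \ {min I, max I}) × J` has the horizontal guard
`b(j) = μ(min I, j)` or `b(j) = μ(max I, j)`. -/
def IsInnerHorizontal {M I J : Type*} [LinearOrder I] [LinearOrder J]
    [Fintype I] [Nonempty I] (E prec : M → M → Prop) (μ : I × J → M) : Prop :=
  IsRegularPair E prec μ μ ∧
  (IsHorizontalGuard E prec (fun p : ↥(innerSet I) × J => μ (↑p.1, p.2))
      (fun j => μ (minOf I, j)) ∨
   IsHorizontalGuard E prec (fun p : ↥(innerSet I) × J => μ (↑p.1, p.2))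
      (fun j => μ (maxOf I, j)))

/-- A pair of meshes is conducting if either `|I| = |J| ≤ 3`, or it is regular but not
homogeneous. -/
def IsConductingPair {M I J : Type*} [LinearOrder I] [LinearOrder J]
    [Fintype I] [Fintype J] (E prec : M → M → Prop) (μ μ' : I × J → M) : Prop :=
  (Fintype.card I = Fintype.card J ∧ Fintype.card J ≤ 3) ∨
  (IsRegularPair E prec μ μ' ∧ ¬ IsHomogeneousPair E prec μ μ')

/-- The triples of order types `(otp(i,j), otp(j,k), otp(i,k))` realized by three elements of
a linear order. -/
def OrdCompat (a b c : Ordering) : Prop :=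
  ∃ i j k : Fin 3, cmp i j = a ∧ cmp j k = b ∧ cmp i k = c

instance (a b c : Ordering) : Decidable (OrdCompat a b c) := by
  unfold OrdCompat; infer_instance

lemma OrdCompat.swap {a b c : Ordering} (h : OrdCompat a b c) :
    OrdCompat a.swap b.swap c.swap := by
  revert a b c; decide

lemma OrdCompat.exists_of_card {I : Type*} [LinearOrder I] [Fintype I]
    (hI : 3 ≤ Fintype.card I) {a b c : Ordering} (h : OrdCompat a b c) :
    ∃ i j k : I, cmp i j = a ∧ cmp j k = b ∧ cmp i k = c := by
  obtain ⟨i, j, k, h₁, h₂, h₃⟩ := h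
  have he : StrictMono ((Finset.univ.orderEmbOfFin rfl : Fin (Fintype.card I) ↪o I) ∘
      Fin.castLE hI) :=
    (OrderEmbedding.strictMono _).comp (Fin.strictMono_castLE hI)
  exact ⟨_, _, _, (he.cmp_map_eq i j).trans h₁, (he.cmp_map_eq j k).trans h₂,
    (he.cmp_map_eq i k).trans h₃⟩

/-- The pattern of a tree-order on two regular meshes indexed by `Bool`: `R u v a b` says that
`m u (i, j)` precedes `m v (i', j')` when `otp(i,i') = a` and `otp(j,j') = b`. -/
structure IsTreePattern (R : Bool → Bool → Ordering → Ordering → Prop) : Prop where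
  trans : ∀ u v w a b c a' b' c', OrdCompat a b c → OrdCompat a' b' c' →
    R u v a a' → R v w b b' → R u w c c'
  asymm : ∀ u v a a', R u v a a' → ¬ R v u a.swap a'.swap
  tree : ∀ u v w a b c a' b' c', OrdCompat c b a → OrdCompat c' b' a' →
    (c ≠ .eq ∨ c' ≠ .eq) → R u w a a' → R v w b b' → R u v c c' ∨ R v u c.swap c'.swap

/-- Columns are chains, and the relation between different columns depends only on the order
type of their indices. -/
def IsColumnPattern (X : Ordering → Ordering → Prop) : Prop :=
  (X .eq .lt ∨ X .eq .gt) ∧ ∀ p q q', p ≠ .eq → X p q → X p q'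

namespace IsTreePattern

variable {R : Bool → Bool → Ordering → Ordering → Prop}

lemma transpose (h : IsTreePattern R) : IsTreePattern fun u v a b => R (!u) (!v) b a where
  trans _ _ _ _ _ _ _ _ _ hc hc' := h.trans _ _ _ _ _ _ _ _ _ hc' hc
  asymm _ _ _ _ := h.asymm _ _ _ _
  tree _ _ _ _ _ _ _ _ _ hc hc' hne := h.tree _ _ _ _ _ _ _ _ _ hc' hc hne.symm

lemma swap_left (h : IsTreePattern R) : IsTreePattern fun u v a b => R u v a.swap b where
  trans _ _ _ _ _ _ _ _ _ hc hc' := h.trans _ _ _ _ _ _ _ _ _ hc.swap hc'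
  asymm _ _ _ _ := h.asymm _ _ _ _
  tree _ _ _ _ _ c _ _ _ hc hc' hne :=
    h.tree _ _ _ _ _ _ _ _ _ hc.swap hc' (hne.imp_left (by clear * -; revert c; decide))

lemma swap_right (h : IsTreePattern R) : IsTreePattern fun u v a b => R u v a b.swap where
  trans _ _ _ _ _ _ _ _ _ hc hc' := h.trans _ _ _ _ _ _ _ _ _ hc hc'.swap
  asymm _ _ _ _ := h.asymm _ _ _ _
  tree _ _ _ _ _ _ _ _ c' hc hc' hne :=
    h.tree _ _ _ _ _ _ _ _ _ hc hc'.swap (hne.imp_right (by clear * -; revert c'; decide))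

lemma spread_of_eq_lt (h : IsTreePattern R) (u : Bool) (h₀ : R u u .eq .lt)
    (hnc : ¬ ((∀ p p', R u u p .lt → R u u p' .lt) ∧ ∀ p p', R u u p .gt → R u u p' .gt))
    {q : Ordering} (hlt : R u u .lt q) (q' : Ordering) : R u u .lt q' := by
  have hll : R u u .lt .lt :=
    h.trans u u u .lt .eq .lt q .lt .lt (by decide) (by clear * -; revert q; decide) hlt h₀
  have hlg : R u u .lt .gt := by
    rcases h.tree u u u .lt .lt .lt .lt .lt .gt (by decide) (by decide) (by decide) hll hll
      with h₁ | h₁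
    · exact h₁
    · refine (hnc ⟨?_, ?_⟩).elim
      · rintro - (_ | _ | _) - <;> assumption
      · rintro (_ | _ | _) p' hp
        · exact (h.asymm _ _ _ _ hp h₁).elim
        · exact (h.asymm _ _ _ _ hp h₀).elim
        · exact (h.asymm _ _ _ _ hp hll).elim
  rcases q' with _ | _ | _
  · exact hll
  · exact h.trans u u u .lt .eq .lt .gt .lt .eq (by decide) (by decide) hlg h₀
  · exact hlg

lemma isColumnPattern_of_eq_lt (h : IsTreePattern R) (u : Bool) (h₀ : R u u .eq .lt)
    (hnc : ¬ ((∀ p p', R u u p .lt → R u u p' .lt) ∧ ∀ p p', R u u p .gt → R u u p' .gt)) :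
    IsColumnPattern (R u u) := by
  refine ⟨Or.inl h₀, ?_⟩
  rintro (_ | _ | _) q q' hp hq
  · exact h.spread_of_eq_lt u h₀ hnc hq q'
  · exact absurd rfl hp
  · refine h.swap_left.spread_of_eq_lt u h₀ (fun hc => hnc ?_) hq q'
    exact ⟨fun p p' hpp => by simpa using hc.1 p.swap p'.swap (by simpa using hpp),
      fun p p' hpp => by simpa using hc.2 p.swap p'.swap (by simpa using hpp)⟩

lemma isColumnPattern (h : IsTreePattern R) (u : Bool)
    (hnc : ¬ ((∀ p p', R u u p .lt → R u u p' .lt) ∧ ∀ p p', R u u p .gt → R u u p' .gt)) :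
    IsColumnPattern (R u u) := by
  have h₀ : R u u .eq .lt ∨ R u u .eq .gt := by
    by_contra hno
    have key : ∀ p q, q ≠ .eq → ¬ R u u p q := by
      intro p q hq hpq
      rcases h.tree u u u p p .eq q q .lt (by clear * -; revert p; decide)
        (by clear * - hq; revert q; decide) (by decide) hpq hpq with h₁ | h₁
      · exact hno (Or.inl h₁)
      · exact hno (Or.inr h₁)
    exact hnc ⟨fun p p' hp => (key p _ (by decide) hp).elim,
      fun p p' hp => (key p _ (by decide) hp).elim⟩
  rcases h₀ with h₀ | h₀
  · exact h.isColumnPattern_of_eq_lt u h₀ hnc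
  · have := h.swap_right.isColumnPattern_of_eq_lt u h₀ (fun hc => hnc hc.symm)
    exact ⟨Or.inr h₀, fun p q q' hp hq => by
      simpa using this.2 p q.swap q'.swap hp (by simpa using hq)⟩

/-- If the columns of the first mesh and the rows of the second mesh are increasing chains,
then any precedence from the first mesh to the second one holds everywhere. -/
lemma cross_of_increasing (h : IsTreePattern R) (hx : R false false .eq .lt)
    (hX : ∀ p q q', p ≠ .eq → R false false p q → R false false p q')
    (hy : R true true .lt .eq)
    (hY : ∀ q p p', q ≠ .eq → R true true p q → R true true p' q)
    {p q : Ordering} (hpq : R false true p q) (p' q' : Ordering) : R false true p' q' := by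
  have hpl : R false true p .lt :=
    h.trans _ _ _ .eq p p .lt q .lt (by clear * -; revert p; decide)
      (by clear * -; revert q; decide) hx hpq
  have hll : R false true .lt .lt :=
    h.trans _ _ _ p .lt .lt .lt .eq .lt (by clear * -; revert p; decide) (by decide) hpl hy
  have hcomp : ∀ q b, ∃ r, OrdCompat q r b := by decide
  have hcomp' : ∀ b, ∃ r, OrdCompat r .lt b := by decide
  rcases h.tree false false true .lt .lt .lt .lt .lt .lt (by decide) (by decide) (by decide)
    hll hll with hX₁ | hX₁
  · have hX₁ : ∀ q, R false false .lt q := fun q => hX _ _ q (by decide) hX₁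
    have hlt : ∀ q, R false true .lt q := fun q => by
      obtain ⟨r, hr⟩ := hcomp' q
      exact h.trans _ _ _ .lt .lt .lt r .lt q (by decide) hr (hX₁ r) hll
    have hgt : ∀ q, R false true .gt q := fun q => by
      rcases h.tree false true true .lt .lt .gt q .eq q (by decide) (by clear * -; revert q; decide)
        (Or.inl (by decide)) (hlt q) hy with h₁ | h₁
      · exact h₁
      have hT : ∀ s, R true false .lt s := fun s => by
        obtain ⟨r, hr⟩ := hcomp q.swap s
        exact h.trans _ _ _ .lt .lt .lt q.swap r s (by decide) hr h₁ (hX₁ r)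
      have hY₁ : ∀ s, R true true .lt s := fun s =>
        h.trans _ _ _ .lt .lt .lt s .eq s (by decide) (by clear * -; revert s; decide)
          (hT s) (hlt .eq)
      exact (h.asymm _ _ _ _ (hY₁ .gt) (hY .lt _ _ (by decide) (hY₁ .lt))).elim
    rcases p' with _ | _ | _
    · exact hlt q'
    · exact h.trans _ _ _ .lt .gt .eq .eq q' q' (by decide) (by clear * -; revert q'; decide)
        (hX₁ .eq) (hgt q')
    · exact hgt q'
  · have hX₁ : ∀ q, R false false .gt q := fun q => hX _ _ q (by decide) hX₁
    have hge : ∀ c q, c ≠ .lt → R false true c q := fun c q hc => by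
      obtain ⟨r, hr⟩ := hcomp' q
      exact h.trans _ _ _ .gt .lt c r .lt q (by clear * - hc; revert c; decide) hr (hX₁ r) hll
    rcases p' with _ | _ | _
    · exact h.trans _ _ _ .eq .lt .lt q' .eq q' (by decide) (by clear * -; revert q'; decide)
        (hge .eq q' (by decide)) hy
    · exact hge _ _ (by decide)
    · exact hge _ _ (by decide)

lemma cross_of_row_increasing (h : IsTreePattern R) (hX : IsColumnPattern (R false false))
    (hy : R true true .lt .eq)
    (hY : ∀ q p p', q ≠ .eq → R true true p q → R true true p' q)
    {p q : Ordering} (hpq : R false true p q) (p' q' : Ordering) : R false true p' q' := by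
  obtain ⟨hx | hx, hX⟩ := hX
  · exact h.cross_of_increasing hx hX hy hY hpq p' q'
  · simpa using h.swap_right.cross_of_increasing (p := p) (q := q.swap) hx
      (fun p q q' => hX p q.swap q'.swap) hy
      (fun q p p' hq => hY q.swap p p' (by clear * - hq; revert q; decide))
      (by simpa using hpq) p' q'.swap

lemma cross (h : IsTreePattern R) (hX : IsColumnPattern (R false false))
    (hY : IsColumnPattern fun a b => R true true b a)
    {p q : Ordering} (hpq : R false true p q) (p' q' : Ordering) : R false true p' q' := by
  obtain ⟨hy | hy, hY⟩ := hY
  · exact h.cross_of_row_increasing hX hy hY hpq p' q'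
  · simpa using h.swap_left.cross_of_row_increasing (p := p.swap) (q := q)
      ⟨hX.1, fun p q q' hp => hX.2 p.swap q q' (by clear * - hp; revert p; decide)⟩ hy
      (fun q p p' => hY q p.swap p'.swap) (by simpa using hpq) p'.swap q'

lemma cross_symm (h : IsTreePattern R) (hX : IsColumnPattern (R false false))
    (hY : IsColumnPattern fun a b => R true true b a)
    {p q : Ordering} (hpq : R true false p q) (p' q' : Ordering) : R true false p' q' :=
  h.transpose.cross (p := q) (q := p) hY hX hpq q' p'

end IsTreePattern

section Meshes

variable {M I J : Type*} [LinearOrder I] [LinearOrder J] {E prec : M → M → Prop}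

/-- The precedence pattern of a family of meshes. -/
def precPattern (prec : M → M → Prop) (m : Bool → I × J → M) (u v : Bool)
    (a b : Ordering) : Prop :=
  ∃ i i' j j', cmp i i' = a ∧ cmp j j' = b ∧ prec (m u (i, j)) (m v (i', j'))

lemma precPattern_iff {m : Bool → I × J → M}
    (hm : ∀ u v, u ≤ v → IsRegularPair E prec (m u) (m v))
    (u v : Bool) (i i' : I) (j j' : J) :
    precPattern prec m u v (cmp i i') (cmp j j') ↔ prec (m u (i, j)) (m v (i', j')) := by
  refine ⟨?_, fun h => ⟨i, i', j, j', rfl, rfl, h⟩⟩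
  rintro ⟨k, k', l, l', hk, hl, h⟩
  rcases le_total u v with huv | huv
  · exact (hm u v huv _ _ _ _ _ _ _ _ hk hl).2.2.1.1 h
  · refine (hm v u huv _ _ _ _ _ _ _ _ ?_ ?_).2.2.2.1 h
    · exact cmp_eq_cmp_symm.1 hk
    · exact cmp_eq_cmp_symm.1 hl

lemma eq_index_of_eq [Fintype I] [Fintype J] {μ μ' : I × J → M}
    (hI : 3 ≤ Fintype.card I) (hJ : 3 ≤ Fintype.card J)
    (hreg : IsRegularPair E prec μ μ') (hμ' : Function.Injective μ')
    {i i' : I} {j j' : J} (h : μ (i, j) = μ' (i', j')) : (i, j) = (i', j') := by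
  have hfork : ∀ a : Ordering, a ≠ .eq → ∃ c, c ≠ .eq ∧ OrdCompat a c a := by decide
  by_contra hne
  rw [Prod.mk.injEq, not_and_or] at hne
  rcases hne with hne | hne
  · obtain ⟨c, hc, hcc⟩ := hfork (cmp i i') (by rwa [Ne, cmp_eq_eq_iff])
    obtain ⟨k₁, k₂, k₃, h₁, h₂, h₃⟩ := hcc.exists_of_card hI
    have e₁ := (hreg _ _ _ _ _ _ _ _ h₁.symm rfl).1.1 h
    have e₂ := (hreg _ _ _ _ _ _ _ _ h₃.symm rfl).1.1 h
    have := congrArg Prod.fst (hμ' (e₁.symm.trans e₂))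
    exact hc (h₂.symm.trans ((cmp_eq_eq_iff _ _).2 this))
  · obtain ⟨c, hc, hcc⟩ := hfork (cmp j j') (by rwa [Ne, cmp_eq_eq_iff])
    obtain ⟨k₁, k₂, k₃, h₁, h₂, h₃⟩ := hcc.exists_of_card hJ
    have e₁ := (hreg _ _ _ _ _ _ _ _ rfl h₁.symm).1.1 h
    have e₂ := (hreg _ _ _ _ _ _ _ _ rfl h₃.symm).1.1 h
    have := congrArg Prod.snd (hμ' (e₁.symm.trans e₂))
    exact hc (h₂.symm.trans ((cmp_eq_eq_iff _ _).2 this))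

lemma containsBiclique_of_half_graph [Fintype I] (hE_irr : ∀ x, ¬ E x x) {t : ℕ}
    (hI : 2 * t ≤ Fintype.card I) {u v : I → M} (hu : Function.Injective u)
    (hv : Function.Injective v) (h : ∀ i i', i < i' → E (u i) (v i')) :
    ContainsBiclique E t t := by
  classical
  let e : Fin (Fintype.card I) ↪o I := Finset.univ.orderEmbOfFin rfl
  let lo : Fin t ↪ I := ⟨fun k => e ⟨k, by omega⟩, fun k l hkl => by
    simpa [Fin.ext_iff] using e.injective hkl⟩
  let hi : Fin t ↪ I := ⟨fun k => e ⟨t + k, by omega⟩, fun k l hkl => by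
    simpa [Fin.ext_iff] using e.injective hkl⟩
  have hadj : ∀ k l, E (u (lo k)) (v (hi l)) := fun k l =>
    h _ _ (e.strictMono (by rw [Fin.lt_def]; dsimp only; omega))
  refine ⟨Finset.univ.map (lo.trans ⟨u, hu⟩), Finset.univ.map (hi.trans ⟨v, hv⟩),
    ?_, by simp, by simp, ?_⟩
  · rw [Finset.disjoint_left]
    intro x hx hx'
    obtain ⟨k, -, rfl⟩ := Finset.mem_map.1 hx
    obtain ⟨l, -, hl⟩ := Finset.mem_map.1 hx'
    have := hadj k l
    simp only [Function.Embedding.trans_apply, Function.Embedding.coeFn_mk] at hl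
    rw [hl] at this
    exact hE_irr _ this
  · intro x hx y hy
    obtain ⟨k, -, rfl⟩ := Finset.mem_map.1 hx
    obtain ⟨l, -, rfl⟩ := Finset.mem_map.1 hy
    exact hadj k l

lemma index_eq_of_adj [Fintype I] (hE_symm : ∀ x y, E x y → E y x) (hE_irr : ∀ x, ¬ E x x)
    {t : ℕ} (hbic : ¬ ContainsBiclique E t t) (hI : 2 * t ≤ Fintype.card I) {u v : I → M}
    (hu : Function.Injective u) (hv : Function.Injective v)
    (hreg : ∀ i i' k k', cmp i i' = cmp k k' → E (u i) (v i') → E (u k) (v k'))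
    {i i' : I} (h : E (u i) (v i')) : i = i' := by
  rcases lt_trichotomy i i' with hlt | heq | hgt
  · refine (hbic (containsBiclique_of_half_graph hE_irr hI hu hv fun k k' hk => ?_)).elim
    exact hreg i i' k k' (((cmp_eq_lt_iff _ _).2 hlt).trans ((cmp_eq_lt_iff _ _).2 hk).symm) h
  · exact heq
  · refine (hbic (containsBiclique_of_half_graph hE_irr hI hv hu fun k k' hk => ?_)).elim
    exact hE_symm _ _ (hreg i i' k' k
      (((cmp_eq_gt_iff _ _).2 hgt).trans ((cmp_eq_gt_iff _ _).2 hk).symm) h)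

lemma eq_index_of_adj [Fintype I] [Fintype J] (hE_symm : ∀ x y, E x y → E y x)
    (hE_irr : ∀ x, ¬ E x x) {t : ℕ} (hbic : ¬ ContainsBiclique E t t)
    (hI : 2 * t ≤ Fintype.card I) (hJ : 2 * t ≤ Fintype.card J) {μ μ' : I × J → M}
    (hμ : Function.Injective μ) (hμ' : Function.Injective μ')
    (hreg : IsRegularPair E prec μ μ') {i i' : I} {j j' : J}
    (h : E (μ (i, j)) (μ' (i', j'))) : (i, j) = (i', j') := by
  refine Prod.ext ?_ ?_
  · exact index_eq_of_adj hE_symm hE_irr hbic hI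
      (hμ.comp (Prod.mk_left_injective j)) (hμ'.comp (Prod.mk_left_injective j'))
      (fun k k' l l' hk => (hreg _ _ _ _ _ _ _ _ hk rfl).2.1.1) h
  · exact index_eq_of_adj hE_symm hE_irr hbic hJ
      (hμ.comp (Prod.mk_right_injective i)) (hμ'.comp (Prod.mk_right_injective i'))
      (fun k k' l l' hk => (hreg _ _ _ _ _ _ _ _ rfl hk).2.1.1) h

lemma isTreePattern_precPattern [Fintype I] [Fintype J] (htree : IsTreeOrder prec)
    (hI : 3 ≤ Fintype.card I) (hJ : 3 ≤ Fintype.card J) {m : Bool → I × J → M}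
    (hinj : ∀ u, Function.Injective (m u))
    (hm : ∀ u v, u ≤ v → IsRegularPair E prec (m u) (m v)) :
    IsTreePattern (precPattern prec m) := by
  have hiff := precPattern_iff hm
  have hne : ∀ u v i i' j j', m u (i, j) = m v (i', j') → (i, j) = (i', j') := by
    intro u v i i' j j' h
    rcases le_total u v with huv | huv
    · exact eq_index_of_eq hI hJ (hm u v huv) (hinj v) h
    · exact (eq_index_of_eq hI hJ (hm v u huv) (hinj u) h.symm).symm
  refine ⟨?_, ?_, ?_⟩
  · intro u v w a b c a' b' c' hc hc' h₁ h₂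
    obtain ⟨i, k, l, rfl, rfl, rfl⟩ := hc.exists_of_card hI
    obtain ⟨i', k', l', rfl, rfl, rfl⟩ := hc'.exists_of_card hJ
    rw [hiff] at *
    exact htree.2.1 _ _ _ h₁ h₂
  · rintro u v a a' ⟨i, i', j, j', rfl, rfl, h⟩ h'
    rw [cmp_swap, cmp_swap, hiff] at h'
    exact htree.1 _ (htree.2.1 _ _ _ h h')
  · intro u v w a b c a' b' c' hc hc' hcc h₁ h₂
    obtain ⟨i, k, l, rfl, rfl, rfl⟩ := hc.exists_of_card hI
    obtain ⟨i', k', l', rfl, rfl, rfl⟩ := hc'.exists_of_card hJ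
    rw [cmp_swap, cmp_swap]
    rw [hiff] at *
    rw [hiff]
    rcases htree.2.2.2 _ _ _ h₁ h₂ with h | h | h
    · exact Or.inl h
    · have := hne _ _ _ _ _ _ h
      rw [Prod.mk.injEq] at this
      simp [this] at hcc
    · exact Or.inr h

lemma minOf_lt [Fintype J] [Nonempty J] {j : J} (hj : j ∈ innerSet J) : minOf J < j :=
  lt_of_le_of_ne (Finset.min'_le _ _ (Finset.mem_univ j)) (Ne.symm hj.1)

lemma lt_maxOf [Fintype J] [Nonempty J] {j : J} (hj : j ∈ innerSet J) : j < maxOf J :=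
  lt_of_le_of_ne (Finset.le_max' _ _ (Finset.mem_univ j)) hj.2

end Meshes

theorem stmt10 {M I J : Type*} (E prec : M → M → Prop)
    (hE_symm : ∀ x y, E x y → E y x) (hE_irr : ∀ x, ¬ E x x)
    (htree : IsTreeOrder prec)
    (t : ℕ) (ht : 0 < t) (hbic : ¬ ContainsBiclique E t t)
    [LinearOrder I] [LinearOrder J] [Fintype I] [Fintype J] [Nonempty I] [Nonempty J]
    (hcard : max (2 * t) 4 ≤ min (Fintype.card I) (Fintype.card J))
    (μ μ' : I × J → M) (hμ : Function.Injective μ) (hμ' : Function.Injective μ')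
    (hcond : IsConductingPair E prec μ μ')
    (hiv : IsInnerVertical E prec μ) (hih : IsInnerHorizontal E prec μ') :
    IsMatchingPair E prec μ μ' ∧
    (∀ (i i₂ : I) (j j₂ : J) (i' i₂' : I) (j' j₂' : J),
      (prec (μ (i, j)) (μ' (i', j')) ↔ prec (μ (i₂, j₂)) (μ' (i₂', j₂'))) ∧
      (prec (μ' (i', j')) (μ (i, j)) ↔ prec (μ' (i₂', j₂')) (μ (i₂, j₂)))) := by
  classical
  have hI4 : 4 ≤ Fintype.card I := by omega
  have hJ4 : 4 ≤ Fintype.card J := by omega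
  have hI : 3 ≤ Fintype.card I := by omega
  have hJ : 3 ≤ Fintype.card J := by omega
  have hIt : 2 * t ≤ Fintype.card I := by omega
  have hJt : 2 * t ≤ Fintype.card J := by omega
  obtain ⟨hreg, hnh⟩ : IsRegularPair E prec μ μ' ∧ ¬ IsHomogeneousPair E prec μ μ' := by
    rcases hcond with h | h
    · omega
    · exact h
  let m : Bool → I × J → M := fun u => cond u μ' μ
  have hm : ∀ u v, u ≤ v → IsRegularPair E prec (m u) (m v) := by
    rintro (_ | _) (_ | _) h
    · exact hiv.1
    · exact hreg
    · exact absurd h (by decide)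
    · exact hih.1
  have hinj : ∀ u, Function.Injective (m u) := by rintro (_ | _) <;> assumption
  have hR := isTreePattern_precPattern htree hI hJ hinj hm
  have hiff := precPattern_iff hm
  have hatp : ∀ u v, u ≤ v → ∀ i₁ i₁' i₂ i₂' j₁ j₁' j₂ j₂',
      (i₁, j₁) ≠ (i₁', j₁') → (i₂, j₂) ≠ (i₂', j₂') →
      (precPattern prec m u v (cmp i₁ i₁') (cmp j₁ j₁') ↔
        precPattern prec m u v (cmp i₂ i₂') (cmp j₂ j₂')) →
      (precPattern prec m v u (cmp i₁' i₁) (cmp j₁' j₁) ↔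
        precPattern prec m v u (cmp i₂' i₂) (cmp j₂' j₂)) →
      AtpEq E prec (m u (i₁, j₁)) (m v (i₁', j₁')) (m u (i₂, j₂)) (m v (i₂', j₂')) := by
    intro u v huv i₁ i₁' i₂ i₂' j₁ j₁' j₂ j₂' hne₁ hne₂ h₁ h₂
    rw [hiff, hiff] at h₁ h₂
    have hE := fun i i' j j' => eq_index_of_adj (i := i) (i' := i') (j := j) (j' := j')
      hE_symm hE_irr hbic hIt hJt (hinj u) (hinj v) (hm u v huv)
    have heq := fun i i' j j' => eq_index_of_eq (i := i) (i' := i') (j := j) (j' := j')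
      hI hJ (hm u v huv) (hinj v)
    exact ⟨iff_of_false (fun h => hne₁ (heq _ _ _ _ h)) (fun h => hne₂ (heq _ _ _ _ h)),
      iff_of_false (fun h => hne₁ (hE _ _ _ _ h)) (fun h => hne₂ (hE _ _ _ _ h)), h₁, h₂⟩
  have hX : IsColumnPattern (precPattern prec m false false) := by
    refine hR.isColumnPattern false fun ⟨hlt, hgt⟩ => ?_
    rcases hiv.2 with hg | hg
    · refine hg.2 fun i i' i₂ i₂' j j₂ => ?_
      refine hatp false false le_rfl _ _ _ _ _ _ _ _
        (fun h => (minOf_lt j.2).ne' (congrArg Prod.snd h))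
        (fun h => (minOf_lt j₂.2).ne' (congrArg Prod.snd h)) ?_ ?_
      · rw [(cmp_eq_gt_iff _ _).2 (minOf_lt j.2), (cmp_eq_gt_iff _ _).2 (minOf_lt j₂.2)]
        exact ⟨hgt _ _, hgt _ _⟩
      · rw [(cmp_eq_lt_iff _ _).2 (minOf_lt j.2), (cmp_eq_lt_iff _ _).2 (minOf_lt j₂.2)]
        exact ⟨hlt _ _, hlt _ _⟩
    · refine hg.2 fun i i' i₂ i₂' j j₂ => ?_
      refine hatp false false le_rfl _ _ _ _ _ _ _ _
        (fun h => (lt_maxOf j.2).ne (congrArg Prod.snd h))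
        (fun h => (lt_maxOf j₂.2).ne (congrArg Prod.snd h)) ?_ ?_
      · rw [(cmp_eq_lt_iff _ _).2 (lt_maxOf j.2), (cmp_eq_lt_iff _ _).2 (lt_maxOf j₂.2)]
        exact ⟨hlt _ _, hlt _ _⟩
      · rw [(cmp_eq_gt_iff _ _).2 (lt_maxOf j.2), (cmp_eq_gt_iff _ _).2 (lt_maxOf j₂.2)]
        exact ⟨hgt _ _, hgt _ _⟩
  have hY : IsColumnPattern fun a b => precPattern prec m true true b a := by
    refine hR.transpose.isColumnPattern false fun ⟨hlt, hgt⟩ => ?_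
    rcases hih.2 with hg | hg
    · refine hg.2 fun j j' j₂ j₂' i i₂ => ?_
      refine hatp true true le_rfl _ _ _ _ _ _ _ _
        (fun h => (minOf_lt i.2).ne' (congrArg Prod.fst h))
        (fun h => (minOf_lt i₂.2).ne' (congrArg Prod.fst h)) ?_ ?_
      · rw [(cmp_eq_gt_iff _ _).2 (minOf_lt i.2), (cmp_eq_gt_iff _ _).2 (minOf_lt i₂.2)]
        exact ⟨hgt _ _, hgt _ _⟩
      · rw [(cmp_eq_lt_iff _ _).2 (minOf_lt i.2), (cmp_eq_lt_iff _ _).2 (minOf_lt i₂.2)]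
        exact ⟨hlt _ _, hlt _ _⟩
    · refine hg.2 fun j j' j₂ j₂' i i₂ => ?_
      refine hatp true true le_rfl _ _ _ _ _ _ _ _
        (fun h => (lt_maxOf i.2).ne (congrArg Prod.fst h))
        (fun h => (lt_maxOf i₂.2).ne (congrArg Prod.fst h)) ?_ ?_
      · rw [(cmp_eq_lt_iff _ _).2 (lt_maxOf i.2), (cmp_eq_lt_iff _ _).2 (lt_maxOf i₂.2)]
        exact ⟨hlt _ _, hlt _ _⟩
      · rw [(cmp_eq_gt_iff _ _).2 (lt_maxOf i.2), (cmp_eq_gt_iff _ _).2 (lt_maxOf i₂.2)]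
        exact ⟨hgt _ _, hgt _ _⟩
  have hS : ∀ p q p' q', precPattern prec m false true p q ↔
      precPattern prec m false true p' q' := fun p q p' q' =>
    ⟨fun h => hR.cross hX hY h _ _, fun h => hR.cross hX hY h _ _⟩
  have hT : ∀ p q p' q', precPattern prec m true false p q ↔
      precPattern prec m true false p' q' := fun p q p' q' =>
    ⟨fun h => hR.cross_symm hX hY h _ _, fun h => hR.cross_symm hX hY h _ _⟩
  refine ⟨⟨⟨hreg, fun i₁ i₁' i₂ i₂' j₁ j₁' j₂ j₂' h₁ h₂ => ?_⟩, hnh⟩,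
    fun i i₂ j j₂ i' i₂' j' j₂' => ⟨?_, ?_⟩⟩
  · exact hatp false true (by decide) _ _ _ _ _ _ _ _ h₁ h₂ (hS _ _ _ _) (hT _ _ _ _)
  · exact (hiff false true _ _ _ _).symm.trans ((hS _ _ _ _).trans (hiff false true _ _ _ _))
  · exact (hiff true false _ _ _ _).symm.trans ((hT _ _ _ _).trans (hiff true false _ _ _ _))
end

section
/- Let (M, E, ≺) be a tree-ordered graph and let I, J be finite linear orders with |I|, |J| ≥ 4. Let (μ₁, μ₂) be a regular pair of (I,J)-meshes in M such that the restriction of ≺ to V(μ₁) is the lexicographic order, i.e., μ₁(i,j) ≺ μ₁(i',j') if and only if (i < i') ∨ (i = i' ∧ j < j'), and such that V(μ₂) is an antichain for ≺. Then one of the following three alternatives holds for all i, i' ∈ I and j, j' ∈ J: (a) μ₁(i,j) and μ₂(i',j') are ≺-incomparable; (b) if i < i' then μ₁(i,j) ≺ μ₂(i',j'), and if i > i' then μ₁(i,j) and μ₂(i',j') are ≺-incomparable; (c) μ₁(i,j) ≺ μ₂(i',j'). -/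
/-- Two elements are incomparable for `prec` if they are distinct and neither is below
the other. -/
def PrecIncomp {M : Type*} (prec : M → M → Prop) (x y : M) : Prop :=
  x ≠ y ∧ ¬ prec x y ∧ ¬ prec y x

theorem exists_lt_lt_of_three_le_card {I : Type*} [LinearOrder I] [Fintype I]
    (h : 3 ≤ Fintype.card I) : ∃ a b c : I, a < b ∧ b < c := by
  let e := Fintype.orderIsoFinOfCardEq I rfl
  refine ⟨e ⟨0, by lia⟩, e ⟨1, by lia⟩, e ⟨2, by lia⟩, ?_, ?_⟩ <;>
    rw [e.lt_iff_lt] <;> simp [Fin.lt_def]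

theorem exists_cmp_eq {J : Type*} [LinearOrder J] {a b c : J} (hab : a < b) (hbc : b < c)
    (j j' : J) : ∃ k, cmp k b = cmp j j' := by
  rcases lt_trichotomy j j' with h | h | h
  · exact ⟨a, by rw [cmp_eq_lt_iff _ _ |>.2 hab, cmp_eq_lt_iff _ _ |>.2 h]⟩
  · exact ⟨b, by rw [cmp_eq_eq_iff _ _ |>.2 rfl, cmp_eq_eq_iff _ _ |>.2 h]⟩
  · exact ⟨c, by rw [cmp_eq_gt_iff _ _ |>.2 hbc, cmp_eq_gt_iff _ _ |>.2 h]⟩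

theorem exists_cmp_eq_ne {I : Type*} [LinearOrder I] {a b c : I} (hab : a < b) (hbc : b < c)
    (i i' : I) : ∃ k k', cmp k k' = cmp i i' ∧ k' ≠ i' := by
  by_cases hb : b = i'
  · rcases lt_trichotomy i i' with h | h | h
    · exact ⟨a, c, by rw [cmp_eq_lt_iff _ _ |>.2 (hab.trans hbc), cmp_eq_lt_iff _ _ |>.2 h],
        hb ▸ hbc.ne'⟩
    · exact ⟨a, a, by rw [cmp_eq_eq_iff _ _ |>.2 rfl, cmp_eq_eq_iff _ _ |>.2 h], hb ▸ hab.ne⟩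
    · exact ⟨c, a, by rw [cmp_eq_gt_iff _ _ |>.2 (hab.trans hbc), cmp_eq_gt_iff _ _ |>.2 h],
        hb ▸ hab.ne⟩
  · obtain ⟨k, hk⟩ := exists_cmp_eq hab hbc i i'
    exact ⟨k, b, hk, hb⟩

/-- Elements lying weakly below comparable elements of a tree-order are comparable. -/
theorem IsTreeOrder.comparable_of_le {M : Type*} {prec : M → M → Prop} (h : IsTreeOrder prec)
    {x x' y y' : M} (hx : prec x x' ∨ x = x' ∨ prec x' x) (hy : y = x ∨ prec y x)
    (hy' : y' = x' ∨ prec y' x') : prec y y' ∨ y = y' ∨ prec y' y := by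
  obtain ⟨-, htrans, -, hlin⟩ := h
  grind

theorem stmt13 {M I J : Type*} (E prec : M → M → Prop)
    (hE_symm : ∀ x y, E x y → E y x) (hE_irr : ∀ x, ¬ E x x)
    (htree : IsTreeOrder prec)
    [LinearOrder I] [LinearOrder J] [Fintype I] [Fintype J]
    (hcardI : 4 ≤ Fintype.card I) (hcardJ : 4 ≤ Fintype.card J)
    (μ₁ μ₂ : I × J → M) (hμ₁ : Function.Injective μ₁) (hμ₂ : Function.Injective μ₂)
    (hpair : IsRegularPair E prec μ₁ μ₂)
    (hlex : ∀ (i i' : I) (j j' : J),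
      prec (μ₁ (i, j)) (μ₁ (i', j')) ↔ (i < i' ∨ (i = i' ∧ j < j')))
    (hanti : IsPrecAntichain prec (Set.range μ₂)) :
    (∀ (i i' : I) (j j' : J), PrecIncomp prec (μ₁ (i, j)) (μ₂ (i', j'))) ∨
    (∀ (i i' : I) (j j' : J),
      (i < i' → prec (μ₁ (i, j)) (μ₂ (i', j'))) ∧
      (i' < i → PrecIncomp prec (μ₁ (i, j)) (μ₂ (i', j')))) ∨
    (∀ (i i' : I) (j j' : J), prec (μ₁ (i, j)) (μ₂ (i', j'))) := by
  obtain ⟨i₀, i₁, i₂, hi₀, hi₁⟩ := exists_lt_lt_of_three_le_card (by lia : 3 ≤ Fintype.card I)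
  obtain ⟨j₀, j₁, j₂, hj₀, hj₁⟩ := exists_lt_lt_of_three_le_card (by lia : 3 ≤ Fintype.card J)
  have not_le : ∀ (i i' : I) (j j' : J),
      ¬ (μ₂ (i', j') = μ₁ (i, j) ∨ prec (μ₂ (i', j')) (μ₁ (i, j))) := by
    intro i i' j j' h
    obtain ⟨k, k', hk, hne⟩ := exists_cmp_eq_ne hi₀ hi₁ i i'
    obtain ⟨hEq, -, -, hgt⟩ := hpair k k' i i' j j' j j' hk rfl
    have h' : μ₂ (k', j') = μ₁ (k, j) ∨ prec (μ₂ (k', j')) (μ₁ (k, j)) :=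
      h.imp (fun h => (hEq.2 h.symm).symm) hgt.2
    have hx : prec (μ₁ (i, j)) (μ₁ (k, j)) ∨ μ₁ (i, j) = μ₁ (k, j) ∨
        prec (μ₁ (k, j)) (μ₁ (i, j)) := by
      rcases lt_trichotomy i k with hik | rfl | hik
      · exact .inl ((hlex ..).2 (.inl hik))
      · exact .inr (.inl rfl)
      · exact .inr (.inr ((hlex ..).2 (.inl hik)))
    have hy : μ₂ (i', j') ≠ μ₂ (k', j') := fun e => hne (congrArg Prod.fst (hμ₂ e)).symm
    have hanti' := hanti _ ⟨_, rfl⟩ _ ⟨_, rfl⟩ hy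
    rcases htree.comparable_of_le hx h h' with h | h | h
    exacts [hanti'.1 h, hy h, hanti'.2 h]
  have incomp : ∀ (i i' : I) (j j' : J), ¬ prec (μ₁ (i, j)) (μ₂ (i', j')) →
      PrecIncomp prec (μ₁ (i, j)) (μ₂ (i', j')) := fun i i' j j' h =>
    ⟨fun e => not_le i i' j j' (.inl e.symm), h, fun h => not_le i i' j j' (.inr h)⟩
  -- Precedence at one pair of rows transfers to any pair of rows of the same order type
  -- lying over a smaller first row.
  have spread : ∀ {i i' k k' l a a' : I} {j j' : J}, prec (μ₁ (i, j)) (μ₂ (i', j')) →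
      cmp k k' = cmp i i' → l < k → cmp a a' = cmp l k' →
      ∀ b b', prec (μ₁ (a, b)) (μ₂ (a', b')) := by
    intro i i' k k' l a a' j j' h hk hl ha b b'
    obtain ⟨m, hm⟩ := exists_cmp_eq hj₀ hj₁ j j'
    obtain ⟨n, hn⟩ := exists_cmp_eq hj₀ hj₁ b b'
    have hkm := (hpair k k' i i' m j₁ j j' hk hm).2.2.1.2 h
    exact (hpair a a' l k' b b' n j₁ ha hn.symm).2.2.1.2
      (htree.2.1 _ _ _ ((hlex l k n m).2 (.inl hl)) hkm)
  have cmp_lt : ∀ {a b c d : I}, a < b → c < d → cmp a b = cmp c d := fun h h' => by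
    rw [cmp_eq_lt_iff _ _ |>.2 h, cmp_eq_lt_iff _ _ |>.2 h']
  have cmp_gt : ∀ {a b c d : I}, b < a → d < c → cmp a b = cmp c d := fun h h' => by
    rw [cmp_eq_gt_iff _ _ |>.2 h, cmp_eq_gt_iff _ _ |>.2 h']
  by_cases hgt : ∃ (i i' : I) (j j' : J), i' < i ∧ prec (μ₁ (i, j)) (μ₂ (i', j'))
  · obtain ⟨i, i', j, j', hi, h⟩ := hgt
    refine .inr (.inr fun a a' b b' => ?_)
    rcases lt_trichotomy a a' with ha | rfl | ha
    · exact spread h (cmp_gt hi₁ hi) (hi₀.trans hi₁) (cmp_lt ha hi₀) b b'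
    · exact spread h (cmp_gt hi₁ hi) hi₁ (by simp) b b'
    · exact spread h (cmp_gt (hi₀.trans hi₁) hi) hi₁ (cmp_gt ha hi₀) b b'
  push Not at hgt
  by_cases hle : ∃ (i i' : I) (j j' : J), prec (μ₁ (i, j)) (μ₂ (i', j'))
  · obtain ⟨i, i', j, j', h⟩ := hle
    refine .inr (.inl fun a a' b b' => ⟨fun ha => ?_, fun ha => incomp _ _ _ _ (hgt _ _ _ _ ha)⟩)
    rcases lt_trichotomy i i' with hi | rfl | hi
    · exact spread h (cmp_lt hi₁ hi) hi₀ (cmp_lt ha (hi₀.trans hi₁)) b b'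
    · exact spread h (k := i₁) (k' := i₁) (by simp) hi₀ (cmp_lt ha hi₀) b b'
    · exact absurd h (hgt _ _ _ _ hi)
  · push Not at hle
    exact .inl fun i i' j j' => incomp _ _ _ _ (hle i i' j j')
end

section
/- Let (M, E, ≺) be a tree-ordered graph and let I, J be finite linear orders with |I|, |J| ≥ 2. Let μ and μ' be (I,J)-meshes in M such that the pair (μ,μ') is homogeneous and V(μ) is an antichain for ≺. Then no element of V(μ) is ≺-smaller than an element of V(μ'). Consequently, if V(μ') is also an antichain for ≺, then no element of V(μ) is ≺-comparable to an element of V(μ'). -/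
/-- If `(μ, μ')` is homogeneous and the range of `μ` is an antichain for the tree-order, then no
value of `μ` is smaller than a value of `μ'`. -/
theorem IsHomogeneousPair.not_prec_of_antichain {M I J : Type*} [LinearOrder I] [LinearOrder J]
    [Nontrivial (I × J)] {E prec : M → M → Prop} {μ μ' : I × J → M}
    (hhom : IsHomogeneousPair E prec μ μ') (htree : IsTreeOrder prec)
    (hμ : Function.Injective μ) (hanti : IsPrecAntichain prec (Set.range μ)) (p q : I × J) :
    ¬ prec (μ p) (μ' q) := by
  intro h
  obtain ⟨r, hr⟩ := exists_ne p
  have hrq : prec (μ r) (μ' q) := (hhom p.1 q.1 r.1 q.1 p.2 q.2 r.2 q.2).2.2.1.1 h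
  obtain ⟨hrp, hpr⟩ := hanti (μ r) ⟨r, rfl⟩ (μ p) ⟨p, rfl⟩ (hμ.ne hr)
  rcases htree.2.2.2 (μ' q) (μ r) (μ p) hrq h with h' | h' | h'
  · exact hrp h'
  · exact hr (hμ h')
  · exact hpr h'

/-- Swapping the two meshes of a homogeneous pair yields a homogeneous pair. -/
theorem IsHomogeneousPair.symm {M I J : Type*} [LinearOrder I] [LinearOrder J]
    {E prec : M → M → Prop} {μ μ' : I × J → M} (hE_symm : ∀ x y, E x y → E y x)
    (hhom : IsHomogeneousPair E prec μ μ') : IsHomogeneousPair E prec μ' μ := by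
  intro i₁ i₁' i₂ i₂' j₁ j₁' j₂ j₂'
  obtain ⟨heq, hE, hlt, hgt⟩ := hhom i₁' i₁ i₂' i₂ j₁' j₁ j₂' j₂
  have hE_comm : ∀ x y, E x y ↔ E y x := fun x y => ⟨hE_symm x y, hE_symm y x⟩
  exact ⟨by rw [eq_comm, heq, eq_comm], by rw [hE_comm, hE, hE_comm], hgt, hlt⟩

theorem stmt14 {M I J : Type*} (E prec : M → M → Prop)
    (hE_symm : ∀ x y, E x y → E y x) (hE_irr : ∀ x, ¬ E x x)
    (htree : IsTreeOrder prec)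
    [LinearOrder I] [LinearOrder J] [Fintype I] [Fintype J]
    (hcardI : 2 ≤ Fintype.card I) (hcardJ : 2 ≤ Fintype.card J)
    (μ μ' : I × J → M) (hμ : Function.Injective μ) (hμ' : Function.Injective μ')
    (hhom : IsHomogeneousPair E prec μ μ')
    (hanti : IsPrecAntichain prec (Set.range μ)) :
    (∀ (p q : I × J), ¬ prec (μ p) (μ' q)) ∧
    (IsPrecAntichain prec (Set.range μ') →
      ∀ (p q : I × J), ¬ prec (μ p) (μ' q) ∧ ¬ prec (μ' q) (μ p)) := by
  have : Nontrivial I := Fintype.one_lt_card_iff_nontrivial.1 hcardI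
  have : Nontrivial J := Fintype.one_lt_card_iff_nontrivial.1 hcardJ
  exact ⟨hhom.not_prec_of_antichain htree hμ hanti, fun hanti' p q =>
    ⟨hhom.not_prec_of_antichain htree hμ hanti p q,
      (hhom.symm hE_symm).not_prec_of_antichain htree hμ' hanti' q p⟩⟩
end

section
/- Let (M, E, ≺) be a tree-ordered graph and let I, J be finite linear orders with |I|, |J| ≥ 2. Let (μ₁, μ₂) be a quasi-homogeneous pair of (I,J)-meshes in M with disjoint ranges such that the restriction of ≺ to V(μ₁) is the vertical order, i.e., μ₁(i,j) ≺ μ₁(i',j') if and only if (i = i' ∧ j < j'), and such that either V(μ₂) is an antichain for ≺, or the restriction of ≺ to V(μ₂) is the horizontal order, i.e., μ₂(i,j) ≺ μ₂(i',j') if and only if (j = j' ∧ i < i'). Then no element of V(μ₁) is ≺-comparable to an element of V(μ₂). -/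
theorem stmt16 {M I J : Type*} (E prec : M → M → Prop)
    (hE_symm : ∀ x y, E x y → E y x) (hE_irr : ∀ x, ¬ E x x)
    (htree : IsTreeOrder prec)
    [LinearOrder I] [LinearOrder J] [Fintype I] [Fintype J]
    (hcardI : 2 ≤ Fintype.card I) (hcardJ : 2 ≤ Fintype.card J)
    (μ₁ μ₂ : I × J → M) (hμ₁ : Function.Injective μ₁) (hμ₂ : Function.Injective μ₂)
    (hqh : IsQuasiHomogeneousPair E prec μ₁ μ₂)
    (hdisj : Disjoint (Set.range μ₁) (Set.range μ₂))
    (hvert : ∀ (i i' : I) (j j' : J),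
      prec (μ₁ (i, j)) (μ₁ (i', j')) ↔ (i = i' ∧ j < j'))
    (hμ₂shape : IsPrecAntichain prec (Set.range μ₂) ∨
      (∀ (i i' : I) (j j' : J),
        prec (μ₂ (i, j)) (μ₂ (i', j')) ↔ (j = j' ∧ i < i'))) :
    ∀ (p q : I × J), ¬ prec (μ₁ p) (μ₂ q) ∧ ¬ prec (μ₂ q) (μ₁ p) := by
  obtain ⟨-, htrans, -, hlin⟩ := htree
  obtain ⟨hreg, hoff⟩ := hqh
  obtain ⟨x, y, hxy⟩ : ∃ x y : J, x < y := by
    have : Nontrivial J := Fintype.one_lt_card_iff_nontrivial.1 hcardJ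
    exact exists_pair_lt J
  obtain ⟨a, b, hab⟩ : ∃ a b : I, a < b := by
    have : Nontrivial I := Fintype.one_lt_card_iff_nontrivial.1 hcardI
    exact exists_pair_lt I
  have h₁ : ∀ p q : I × J, p ≠ q → ¬ prec (μ₁ p) (μ₂ q) := by
    rintro ⟨i, j⟩ ⟨i', j'⟩ hne h
    have h' : ∀ i₂, (i₂, y) ≠ (a, x) → prec (μ₁ (i₂, y)) (μ₂ (a, x)) := fun i₂ hne₂ =>
      (hoff _ _ _ _ _ _ _ _ hne hne₂).2.2.1.1 h
    rcases hlin _ _ _ (h' a (by simp [hxy.ne'])) (h' b (by simp [hxy.ne'])) with h | h | h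
    · exact hab.ne ((hvert _ _ _ _).1 h).1
    · exact hab.ne (congrArg Prod.fst (hμ₁ h))
    · exact hab.ne' ((hvert _ _ _ _).1 h).1
  have h₂ : ∀ p q : I × J, p ≠ q → ¬ prec (μ₂ q) (μ₁ p) := by
    rintro ⟨i, j⟩ ⟨i', j'⟩ hne h
    have h' : ∀ j₂, (a, x) ≠ (b, j₂) → prec (μ₂ (b, j₂)) (μ₁ (a, x)) := fun j₂ hne₂ =>
      (hoff _ _ _ _ _ _ _ _ hne hne₂).2.2.2.1 h
    have hb : μ₂ (b, x) ≠ μ₂ (b, y) := fun h => hxy.ne (congrArg Prod.snd (hμ₂ h))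
    have hlin' := hlin _ _ _ (h' x (by simp [hab.ne])) (h' y (by simp [hab.ne]))
    rcases hμ₂shape with hs | hs
    · have := hs _ ⟨_, rfl⟩ _ ⟨_, rfl⟩ hb
      tauto
    · rcases hlin' with h | h | h
      · exact hxy.ne ((hs _ _ _ _).1 h).1
      · exact hb h
      · exact hxy.ne' ((hs _ _ _ _).1 h).1
  have hcol : ∀ i, prec (μ₁ (i, x)) (μ₁ (i, y)) := fun i => (hvert _ _ _ _).2 ⟨rfl, hxy⟩
  intro p q
  by_cases hpq : p = q
  · subst hpq
    obtain ⟨i, j⟩ := p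
    have hdiag : ∀ j₂, AtpEq E prec (μ₁ (i, j)) (μ₂ (i, j)) (μ₁ (i, j₂)) (μ₂ (i, j₂)) :=
      fun j₂ => hreg _ _ _ _ _ _ _ _ rfl (by simp)
    refine ⟨fun h => ?_, fun h => ?_⟩
    · exact h₁ (i, x) (i, y) (by simp [hxy.ne])
        (htrans _ _ _ (hcol i) ((hdiag y).2.2.1.1 h))
    · exact h₂ (i, y) (i, x) (by simp [hxy.ne'])
        (htrans _ _ _ ((hdiag x).2.2.2.1 h) (hcol i))
  · exact ⟨h₁ p q hpq, h₂ p q hpq⟩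
end
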